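/- Let n ≥ 2. For every integer i ≥ 2, the homogeneous component S(n)_{[i]} of the special algebra is contained in the F-linear span of the brackets [A,B] with A ∈ S(n)_{[i−1]} and B ∈ S(n)_{[1]}. -/

import Mathlib

open MvPolynomial

noncomputable section

abbrev Wn (F : Type*) [Field F] (n : ℕ) :=
  Derivation F (MvPolynomial (Fin n) F) (MvPolynomial (Fin n) F)

/-- The submodule of polynomials homogeneous of integer degree `d`
(for `d < 0` this is `⊥`). -/
def homZ (F : Type*) [Field F] (n : ℕ) (d : ℤ) : Submodule F (MvPolynomial (Fin n) F) where
  carrier := {p | ∀ m : Fin n →₀ ℕ, coeff m p ≠ 0 → (m.sum fun _ e => (e : ℤ)) = d}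
  zero_mem' := by intro m hm; simp at hm
  add_mem' := by
    intro p q hp hq m hm
    by_cases h : coeff m p = 0
    · refine hq m fun hq0 => hm ?_
      simp [coeff_add, h, hq0]
    · exact hp m h
  smul_mem' := by
    intro c p hp m hm
    refine hp m fun h => hm ?_
    simp [coeff_smul, h]

/-- The homogeneous component `W(n)_{[i]}`. -/
def Wgr (F : Type*) [Field F] (n : ℕ) (i : ℤ) : Submodule F (Wn F n) where
  carrier := {D | ∀ k, D (X k) ∈ homZ F n (i + 1)}
  zero_mem' := by intro k; simp
  add_mem' := by intro D E hD hE k; simpa using add_mem (hD k) (hE k)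
  smul_mem' := by intro c D hD k; simpa using Submodule.smul_mem _ c (hD k)


/-- The divergence of a polynomial vector field. -/
def divg {F : Type*} [Field F] {n : ℕ} (D : Wn F n) : MvPolynomial (Fin n) F :=
  ∑ i, pderiv i (D (X i))

/-- The homogeneous component `S(n)_{[i]} = S(n) ∩ W(n)_{[i]}`. -/
def Sgr (F : Type*) [Field F] (n : ℕ) (i : ℤ) : Set (Wn F n) :=
  {D | divg D = 0} ∩ (Wgr F n i : Set (Wn F n))

section LinearForms

variable {F : Type*} [Field F] {n : ℕ}

/-- The linear form `∑ a_i x_i`. -/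
def linForm (a : Fin n → F) : MvPolynomial (Fin n) F := ∑ i, C (a i) * X i

/-- The constant vector field `∑ v_i ∂_i`. -/
def constField (v : Fin n → F) : Wn F n := ∑ i, v i • pderiv i

lemma derivation_sum_apply {ι : Type*} (s : Finset ι) (D : ι → Wn F n)
    (p : MvPolynomial (Fin n) F) : (∑ i ∈ s, D i) p = ∑ i ∈ s, D i p := by
  classical
  induction s using Finset.induction_on with
  | empty => simp
  | insert i s hi ih => simp [Finset.sum_insert hi, ih]

lemma constField_apply (v : Fin n → F) (p : MvPolynomial (Fin n) F) :
    constField v p = ∑ i, C (v i) * pderiv i p := by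
  simp [constField, derivation_sum_apply, smul_eq_C_mul]

@[simp]
lemma constField_X (v : Fin n → F) (k : Fin n) : constField v (X k) = C (v k) := by
  simp [constField_apply, pderiv_X, Pi.single_apply]

@[simp]
lemma derivation_linForm (D : Wn F n) (a : Fin n → F) :
    D (linForm a) = ∑ i, C (a i) * D (X i) := by
  simp [linForm, Derivation.leibniz]

lemma constField_linForm (a v : Fin n → F) : constField v (linForm a) = C (a ⬝ᵥ v) := by
  simp [dotProduct]

lemma isHomogeneous_linForm (a : Fin n → F) : (linForm a).IsHomogeneous 1 :=
  IsHomogeneous.sum _ _ _ fun i _ => by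
    simpa using (isHomogeneous_C (Fin n) (a i)).mul (isHomogeneous_X F i)

lemma divg_smul_constField (p : MvPolynomial (Fin n) F) (v : Fin n → F) :
    divg (p • constField v) = constField v p := by
  simp [divg, constField_apply, Derivation.leibniz, pderiv_X, Pi.single_apply]

lemma divg_sub (D E : Wn F n) : divg (D - E) = divg D - divg E := by
  simp [divg]

lemma mem_homZ_natCast_iff {p : MvPolynomial (Fin n) F} {d : ℕ} :
    p ∈ homZ F n d ↔ p.IsHomogeneous d := by
  change (∀ m : Fin n →₀ ℕ, coeff m p ≠ 0 → (m.sum fun _ e => (e : ℤ)) = d) ↔ _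
  refine forall_congr' fun m => imp_congr_right fun _ => ?_
  change _ ↔ Finsupp.weight (fun _ => 1) m = d
  rw [← Finsupp.degree_eq_weight_one, Finsupp.degree_apply, Finsupp.sum]
  exact_mod_cast Iff.rfl

lemma smul_constField_mem_Wgr {p : MvPolynomial (Fin n) F} {d : ℕ} {i : ℤ}
    (hp : p.IsHomogeneous d) (hi : i + 1 = d) (v : Fin n → F) : p • constField v ∈ Wgr F n i := by
  intro k
  rw [hi, mem_homZ_natCast_iff]
  simpa using hp.mul (isHomogeneous_C (Fin n) (v k))

/-- Over a field of characteristic zero, powers of linear forms span homogeneous polynomials. -/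
lemma mem_span_linForm_pow [CharZero F] {p : MvPolynomial (Fin n) F} {e : ℕ}
    (hp : p.IsHomogeneous e) :
    p ∈ Submodule.span F (Set.range fun a : Fin n → F => linForm a ^ e) := by
  by_contra hpW
  obtain ⟨φ, hφp, hφ⟩ := Submodule.exists_le_ker_of_notMem hpW
  let Q : MvPolynomial (Fin n) F := ∑ k ∈ Finset.univ.piAntidiag e,
    monomial (Finsupp.equivFunOnFinite.symm k)
      ((Nat.multinomial Finset.univ k : F) * φ (monomial (Finsupp.equivFunOnFinite.symm k) 1))
  have hQ : Q = 0 := by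
    refine MvPolynomial.funext fun a => ?_
    have h : φ (linForm a ^ e) = 0 := hφ (Submodule.subset_span ⟨a, rfl⟩)
    rw [map_zero, ← h, linForm, Finset.sum_pow_eq_sum_piAntidiag, map_sum, map_sum]
    refine Finset.sum_congr rfl fun k _ => ?_
    have hm : (Nat.multinomial Finset.univ k : MvPolynomial (Fin n) F) *
        ∏ i, (C (a i) * X i) ^ k i = ((Nat.multinomial Finset.univ k : F) * ∏ i, a i ^ k i) •
          monomial (Finsupp.equivFunOnFinite.symm k) 1 := by
      rw [monomial_eq, smul_eq_C_mul, Finsupp.prod_fintype _ _ (by simp)]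
      simp [mul_pow, Finset.prod_mul_distrib, mul_assoc]
    rw [hm, map_smul, eval_monomial, Finsupp.prod_fintype _ _ (by simp)]
    simp
    ring
  refine hφp ?_
  rw [p.as_sum, map_sum]
  refine Finset.sum_eq_zero fun m hm => ?_
  have hdeg : m.degree = e := by
    rw [Finsupp.degree_eq_weight_one]; exact hp (mem_support_iff.1 hm)
  have hmem : (m : Fin n → ℕ) ∈ Finset.univ.piAntidiag e := by
    simpa [Finset.mem_piAntidiag, ← Finsupp.degree_eq_sum] using hdeg
  have hc : coeff m Q = 0 := by rw [hQ, coeff_zero]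
  have hcoeff : coeff m Q = (Nat.multinomial Finset.univ m : F) * φ (monomial m 1) := by
    simp only [Q, coeff_sum, coeff_monomial]
    rw [Finset.sum_eq_single_of_mem (m : Fin n → ℕ) hmem]
    · simp
    · intro k _ hk
      refine if_neg fun h => hk ?_
      simp [← h]
  have hφm : φ (monomial m 1) = 0 := by
    rw [hcoeff] at hc
    exact (mul_eq_zero.1 hc).resolve_left (Nat.cast_ne_zero.2 (Nat.multinomial_pos _ _).ne')
  rw [← mul_one (coeff m p), ← smul_eq_mul, ← smul_monomial, map_smul, hφm, smul_zero]

end LinearForms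

section Decomposition

variable {F : Type*} [Field F] {n : ℕ}

/-- The divergence-free vector field `∂_j(g) ∂_k - ∂_k(g) ∂_j`, as a linear function of `g`. -/
def curlField (j k : Fin n) : MvPolynomial (Fin n) F →ₗ[F] Wn F n where
  toFun g := pderiv j g • pderiv k - pderiv k g • pderiv j
  map_add' g h := by simp only [map_add, add_smul]; abel
  map_smul' c g := by simp [smul_sub]

lemma sum_curlField {D : Wn F n} {d : ℕ} (hdiv : divg D = 0)
    (hD : ∀ k, (D (X k)).IsHomogeneous d) :
    ∑ j, ∑ k, curlField j k (X j * D (X k)) = ((n : F) + d - 1) • D := by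
  refine derivation_ext fun l => ?_
  have h1 : ∑ j, pderiv j (X j * D (X l)) = ((n : F) + d) • D (X l) := by
    simp only [Derivation.leibniz, pderiv_X_self, smul_eq_mul, mul_one, Finset.sum_add_distrib,
      (hD l).sum_X_mul_pderiv, Finset.sum_const, Finset.card_univ, Fintype.card_fin, add_smul,
      Nat.cast_smul_eq_nsmul]
    abel
  have h2 : ∑ k, pderiv k (X l * D (X k)) = D (X l) := by
    simp only [Derivation.leibniz, smul_eq_mul, Finset.sum_add_distrib, ← Finset.mul_sum]
    rw [show ∑ k, pderiv k (D (X k)) = 0 from hdiv]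
    simp [pderiv_X, Pi.single_apply]
  simp only [derivation_sum_apply, curlField, LinearMap.coe_mk, AddHom.coe_mk,
    Derivation.sub_apply, Derivation.smul_apply, pderiv_X, Pi.single_apply, smul_eq_mul, mul_ite,
    mul_one, mul_zero, Finset.sum_sub_distrib]
  rw [Finset.sum_comm (f := fun j k => if l = j then pderiv k (X j * D (X k)) else 0)]
  simp only [Finset.sum_ite_eq, Finset.mem_univ, if_true, h1, h2, sub_smul, one_smul]

lemma curlField_linForm_pow (j k : Fin n) (a : Fin n → F) (e : ℕ) :
    curlField j k (linForm a ^ (e + 1)) = ((e : F) + 1) •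
      (linForm a ^ e • constField (Pi.single k (a j) - Pi.single j (a k))) := by
  refine derivation_ext fun l => ?_
  simp [curlField, Derivation.leibniz_pow, pderiv_X, Pi.single_apply, smul_eq_C_mul]
  simp only [apply_ite (C (σ := Fin n)), map_zero]
  split_ifs <;> ring

end Decomposition

section Bracket

variable {F : Type*} [Field F] {n : ℕ}

lemma exists_dotProduct_eq_one {a : Fin n → F} (ha : a ≠ 0) : ∃ w, a ⬝ᵥ w = 1 := by
  obtain ⟨i, hi⟩ := Function.ne_iff.1 ha
  exact ⟨Pi.single i (a i)⁻¹, by simpa using mul_inv_cancel₀ hi⟩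

lemma linForm_pow_smul_constField_mem [CharZero F] {a v : Fin n → F} (hav : a ⬝ᵥ v = 0) (d : ℕ) :
    linForm a ^ (d + 2) • constField v ∈ Submodule.span F {Z : Wn F n |
      ∃ A ∈ Sgr F n d, ∃ B ∈ Sgr F n 1, Z = ⁅A, B⁆} := by
  rcases eq_or_ne a 0 with rfl | ha
  · simp [linForm]
  rcases eq_or_ne v 0 with rfl | hv
  · simp [constField]
  obtain ⟨w, hw⟩ := exists_dotProduct_eq_one ha
  obtain ⟨b, hb⟩ := exists_dotProduct_eq_one hv
  rw [dotProduct_comm] at hb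
  set A : Wn F n := linForm a ^ (d + 1) • constField v with hA
  set B : Wn F n := linForm a ^ 2 • constField w - (2 * linForm a * linForm b) • constField v with hB
  have haA : constField v (linForm a) = 0 := by simp [constField_linForm, hav, -derivation_linForm]
  have hbv : constField v (linForm b) = 1 := by simp [constField_linForm, hb, -derivation_linForm]
  have haw : constField w (linForm a) = 1 := by simp [constField_linForm, hw, -derivation_linForm]
  have h2 : constField v (2 : MvPolynomial (Fin n) F) = 0 := by
    simpa using (constField v).map_natCast 2
  have hAmem : A ∈ Sgr F n d := by
    refine ⟨?_, smul_constField_mem_Wgr ((isHomogeneous_linForm a).pow (d + 1)) (by simp) v⟩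
    simp [hA, divg_smul_constField, Derivation.leibniz_pow, haA, -derivation_linForm]
  have hBmem : B ∈ Sgr F n 1 := by
    refine ⟨?_, sub_mem (smul_constField_mem_Wgr ((isHomogeneous_linForm a).pow 2) (by simp) w)
      (smul_constField_mem_Wgr (d := 2) ?_ (by simp) v)⟩
    · simp [hB, divg_sub, divg_smul_constField, Derivation.leibniz_pow, Derivation.leibniz, haA,
        hbv, haw, h2, -derivation_linForm]
    · rw [← map_ofNat (C : F →+* MvPolynomial (Fin n) F) 2]
      simpa only [zero_add] using ((isHomogeneous_C (Fin n) (2 : F)).mul (isHomogeneous_linForm a)).mul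
        (isHomogeneous_linForm b)
  have hbr : ⁅A, B⁆ = (-((d : F) + 3)) • (linForm a ^ (d + 2) • constField v) := by
    have h3 : C (3 : F) = (3 : MvPolynomial (Fin n) F) := map_ofNat C 3
    refine derivation_ext fun l => ?_
    simp [Derivation.commutator_apply, hA, hB, Derivation.leibniz_pow, Derivation.leibniz, haA,
        hbv, haw, h2, h3, smul_eq_C_mul, -derivation_linForm]
    ring
  have hd : -((d : F) + 3) ≠ 0 := neg_ne_zero.2 (by exact_mod_cast (Nat.succ_ne_zero (d + 2)))
  rw [← inv_smul_smul₀ hd (linForm a ^ (d + 2) • constField v), ← hbr]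
  exact Submodule.smul_mem _ _ (Submodule.subset_span ⟨A, hAmem, B, hBmem, rfl⟩)

lemma curlField_mem [CharZero F] {g : MvPolynomial (Fin n) F} {d : ℕ} (hg : g.IsHomogeneous (d + 3))
    (j k : Fin n) : curlField j k g ∈ Submodule.span F {Z : Wn F n |
      ∃ A ∈ Sgr F n d, ∃ B ∈ Sgr F n 1, Z = ⁅A, B⁆} := by
  have hle : Submodule.span F (Set.range fun a : Fin n → F => linForm a ^ (d + 3)) ≤
      (Submodule.span F {Z : Wn F n | ∃ A ∈ Sgr F n d, ∃ B ∈ Sgr F n 1, Z = ⁅A, B⁆}).comap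
        (curlField j k) := by
    rw [Submodule.span_le]
    rintro _ ⟨a, rfl⟩
    rw [SetLike.mem_coe, Submodule.mem_comap, curlField_linForm_pow]
    refine Submodule.smul_mem _ _ (linForm_pow_smul_constField_mem ?_ d)
    simp [dotProduct_sub, mul_comm]
  exact hle (mem_span_linForm_pow hg)

end Bracket

/-- for `n ≥ 2` and `i ≥ 2`, the component `S(n)_{[i]}` is
contained in the span of the brackets `[A, B]` with `A ∈ S(n)_{[i−1]}`,
`B ∈ S(n)_{[1]}`. -/
theorem stmt8 (F : Type*) [Field F] [CharZero F] (n : ℕ) (hn : 2 ≤ n) :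
    ∀ i : ℤ, 2 ≤ i →
      Sgr F n i ⊆
        ↑(Submodule.span F {Z : Wn F n |
          ∃ A ∈ Sgr F n (i - 1), ∃ B ∈ Sgr F n 1, Z = ⁅A, B⁆}) := by
  rintro i hi D ⟨hdiv, hD⟩
  obtain ⟨d, hd⟩ := Int.eq_ofNat_of_zero_le (show 0 ≤ i - 1 by omega)
  have hhom (k : Fin n) : (D (X k)).IsHomogeneous (d + 2) := by
    rw [← mem_homZ_natCast_iff]
    convert hD k using 2
    push_cast
    omega
  have hc : ((n : F) + (d + 2 : ℕ) - 1) ≠ 0 := by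
    have h : ((n : F) + (d + 2 : ℕ) - 1) = ((n + d + 1 : ℕ) : F) := by push_cast; ring
    rw [h]
    exact Nat.cast_ne_zero.2 (by omega)
  rw [hd, SetLike.mem_coe, ← inv_smul_smul₀ hc D, ← sum_curlField hdiv hhom]
  refine Submodule.smul_mem _ _ (sum_mem fun j _ => sum_mem fun k _ => curlField_mem ?_ j k)
  have h := (isHomogeneous_X F j).mul (hhom k)
  rwa [show 1 + (d + 2) = d + 3 by omega] at h
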